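/- arXiv:1602.07570 — 3 statements merged into one kernel-verified Lean document; each statement's English description precedes it below -/
import Mathlib

section
/- Consider Bayesian Exploration with deterministic utilities. Let π be a BIC iterative recommendation policy that, with probability 1, has chosen every joint action in A at least once by a fixed round T_π ≤ T. Then there exists a BIC iterative recommendation policy π' which coincides with π before round T_π and whose expected reward in every subsequent round is at least OPT(Π_BIC); consequently REW(π') ≥ (T − T_π)·OPT(Π_BIC). -/
open scoped BigOperators

attribute [local instance] Classical.propDecidable

noncomputable section

namespace BE

variable {n : ℕ} {Θ : Type} {A : Fin n → Type} {X : Type} {X' : Type}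

/-- Joint actions: one action per agent. -/
abbrev JA (A : Fin n → Type) : Type := (i : Fin n) → A i

/-- A realized utility vector: the principal's reward together with each agent's utility. -/
abbrev UVec (n : ℕ) : Type := ℝ × (Fin n → ℝ)

/-- A history: the joint actions chosen and the utility vectors realized so far,
most recent round first. -/
abbrev Hist (A : Fin n → Type) : Type := List (JA A × UVec n)

/-- A (discrete) probability mass function. -/
def IsDPMF {V : Type*} (m : V → ℝ) : Prop :=
  (∀ v, 0 ≤ m v) ∧ HasSum m 1

/-- A prior over the finite state space. -/
def IsPrior [Fintype Θ] (ψ : Θ → ℝ) : Prop :=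
  (∀ θ, 0 ≤ ψ θ) ∧ ∑ θ, ψ θ = 1

/-- Rewards and utilities take values in `[0,1]`. -/
def IsUtil (f : JA A → Θ → ℝ) (u : (i : Fin n) → JA A → Θ → ℝ) : Prop :=
  (∀ a θ, f a θ ∈ Set.Icc (0:ℝ) 1) ∧ ∀ i a θ, u i a θ ∈ Set.Icc (0:ℝ) 1

/-- A stochastic-utility environment `D`: for every joint action `a` and state `θ`,
`D a θ` is a distribution over realized utility vectors supported in `[0,1]^{n+1}`
whose coordinate means are `f a θ` and `u i a θ`. -/
def IsEnv (D : JA A → Θ → UVec n → ℝ) (f : JA A → Θ → ℝ)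
    (u : (i : Fin n) → JA A → Θ → ℝ) : Prop :=
  ∀ a θ, IsDPMF (D a θ) ∧
    (∀ v, D a θ v ≠ 0 → v.1 ∈ Set.Icc (0:ℝ) 1 ∧ ∀ i, v.2 i ∈ Set.Icc (0:ℝ) 1) ∧
    (∑' v : UVec n, D a θ v * v.1) = f a θ ∧
    (∀ i, (∑' v : UVec n, D a θ v * v.2 i) = u i a θ)

/-- The deterministic instance: realized utilities deterministically equal expectations. -/
def detD (f : JA A → Θ → ℝ) (u : (i : Fin n) → JA A → Θ → ℝ) :
    JA A → Θ → UVec n → ℝ :=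
  fun a θ v => if v = ((f a θ, fun i => u i a θ) : UVec n) then (1:ℝ) else 0

/-- An iterative recommendation policy, represented by its per-round conditional
action distributions given the history observed so far. -/
def IsPolicy [∀ i, Fintype (A i)] (P : ℕ → Hist A → JA A → ℝ) : Prop :=
  ∀ t h, (∀ a, 0 ≤ P t h a) ∧ ∑ a : JA A, P t h a = 1

/-- Probability, conditional on the realized state `θ`, of observing history `h`
when all agents follow the recommendations of policy `P` in environment `D`. -/
def histProb (P : ℕ → Hist A → JA A → ℝ) (D : JA A → Θ → UVec n → ℝ) (θ : Θ) :
    Hist A → ℝ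
  | [] => 1
  | av :: h => histProb P D θ h * P h.length h av.1 * D av.1 θ av.2

/-- Conditional (on `θ* = θ`) expectation of `g (aₜ, θ)` in round `t` (0-indexed). -/
def roundCond [∀ i, Fintype (A i)] (P : ℕ → Hist A → JA A → ℝ)
    (D : JA A → Θ → UVec n → ℝ) (θ : Θ) (t : ℕ) (g : JA A → Θ → ℝ) : ℝ :=
  ∑' h : Hist A,
    if h.length = t then histProb P D θ h * ∑ a : JA A, P t h a * g a θ else 0

/-- Expectation of `g (aₜ, θ*)` in round `t` (0-indexed). -/
def roundExp [Fintype Θ] [∀ i, Fintype (A i)] (ψ : Θ → ℝ)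
    (P : ℕ → Hist A → JA A → ℝ) (D : JA A → Θ → UVec n → ℝ) (t : ℕ)
    (g : JA A → Θ → ℝ) : ℝ :=
  ∑ θ, ψ θ * roundCond P D θ t g

/-- Conditional (on `θ* = θ`) probability that policy `P` plays the joint action `a`
in round `t` (0-indexed). -/
def probAt [∀ i, Fintype (A i)] (P : ℕ → Hist A → JA A → ℝ)
    (D : JA A → Θ → UVec n → ℝ) (θ : Θ) (t : ℕ) (a : JA A) : ℝ :=
  ∑' h : Hist A, if h.length = t then histProb P D θ h * P t h a else 0

/-- δ-Bayesian incentive-compatibility at round `t` (0-indexed), stated in the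
equivalent indicator-weighted (unconditional) form: for every agent `i` and actions
`ai, ai'`, the expected gain of following the recommendation `ai` over deviating to
`ai'` (weighted by the event of being recommended `ai`) is at least `δ` times the
probability of being recommended `ai`. -/
def BICAt [Fintype Θ] [∀ i, Fintype (A i)] (ψ : Θ → ℝ)
    (P : ℕ → Hist A → JA A → ℝ) (D : JA A → Θ → UVec n → ℝ)
    (u : (i : Fin n) → JA A → Θ → ℝ) (δ : ℝ) (t : ℕ) : Prop :=
  ∀ (i : Fin n) (ai ai' : A i),
    δ * roundExp ψ P D t (fun a _ => if a i = ai then 1 else 0) ≤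
      roundExp ψ P D t
        (fun a θ => if a i = ai then u i a θ - u i (Function.update a i ai') θ else 0)

/-- δ-BIC iterative recommendation policy (`δ = 0` is plain BIC). -/
def IsBIC [Fintype Θ] [∀ i, Fintype (A i)] (ψ : Θ → ℝ)
    (P : ℕ → Hist A → JA A → ℝ) (D : JA A → Θ → UVec n → ℝ)
    (u : (i : Fin n) → JA A → Θ → ℝ) (δ : ℝ) : Prop :=
  IsPolicy P ∧ ∀ t, BICAt ψ P D u δ t

/-- Cumulative expected reward over the first `T` rounds. -/
def REW [Fintype Θ] [∀ i, Fintype (A i)] (ψ : Θ → ℝ)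
    (P : ℕ → Hist A → JA A → ℝ) (D : JA A → Θ → UVec n → ℝ)
    (f : JA A → Θ → ℝ) (T : ℕ) : ℝ :=
  ∑ t ∈ Finset.range T, roundExp ψ P D t f

/-- The one-round benchmark `OPT` over a class `C` of policies. -/
def OPT [Fintype Θ] [∀ i, Fintype (A i)] (ψ : Θ → ℝ)
    (D : JA A → Θ → UVec n → ℝ) (f : JA A → Θ → ℝ)
    (C : (ℕ → Hist A → JA A → ℝ) → Prop) : ℝ :=
  sSup {r : ℝ | ∃ P, C P ∧ ∃ t : ℕ, r = roundExp ψ P D t f}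

/-- A signal structure: the conditional distribution of the signal given the state. -/
def IsSigKernel (q : Θ → X → ℝ) : Prop :=
  ∀ θ, (∀ s, 0 ≤ q θ s) ∧ HasSum (q θ) 1

/-- LP-representation of a recommendation policy in the recommendation game. -/
def IsRecPolicy [∀ i, Fintype (A i)] (x : JA A → X → ℝ) : Prop :=
  (∀ a s, 0 ≤ x a s) ∧ ∀ s, ∑ a : JA A, x a s = 1

/-- Membership in the polytope of δ-BIC recommendation policies (`δ = 0` is `BIC[S]`). -/
def InBIC [Fintype Θ] [∀ i, Fintype (A i)] (ψ : Θ → ℝ) (q : Θ → X → ℝ)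
    (u : (i : Fin n) → JA A → Θ → ℝ) (δ : ℝ) (x : JA A → X → ℝ) : Prop :=
  IsRecPolicy x ∧ ∀ (i : Fin n) (ai ai' : A i),
    δ * (∑ θ, ψ θ * ∑' s : X, q θ s * ∑ a : JA A, (if a i = ai then x a s else 0)) ≤
      ∑ θ, ψ θ * ∑' s : X, q θ s *
        ∑ a : JA A,
          (if a i = ai then (u i a θ - u i (Function.update a i ai') θ) * x a s else 0)

/-- Expected reward of a recommendation policy `x`, with reward function `f`. -/
def recREW [Fintype Θ] [∀ i, Fintype (A i)] (ψ : Θ → ℝ) (q : Θ → X → ℝ)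
    (f : JA A → Θ → ℝ) (x : JA A → X → ℝ) : ℝ :=
  ∑ θ, ψ θ * ∑' s : X, q θ s * ∑ a : JA A, x a s * f a θ

/-- `REW*[S]`: the optimal expected reward over δ-BIC recommendation policies. -/
def REWstar [Fintype Θ] [∀ i, Fintype (A i)] (ψ : Θ → ℝ) (q : Θ → X → ℝ)
    (f : JA A → Θ → ℝ) (u : (i : Fin n) → JA A → Θ → ℝ) (δ : ℝ) : ℝ :=
  sSup {r : ℝ | ∃ x : JA A → X → ℝ, InBIC ψ q u δ x ∧ r = recREW ψ q f x}

/-- `EX_s[S]`: the signal-explorable joint actions at the feasible signal `s`. -/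
def EXs [Fintype Θ] [∀ i, Fintype (A i)] (ψ : Θ → ℝ) (q : Θ → X → ℝ)
    (u : (i : Fin n) → JA A → Θ → ℝ) (s : X) : Set (JA A) :=
  {a | ∃ x : JA A → X → ℝ, InBIC ψ q u 0 x ∧ 0 < x a s}

/-- Value type of the `AllInfo` signal. -/
abbrev AIVal (A : Fin n → Type) : Type := Finset (JA A) × (JA A → UVec n)

/-- The realization, at state `θ`, of the signal `AllInfo(B)`: the set `B θ` together
with the rewards/utilities of all joint actions in `B θ`. -/
def allInfoVal [∀ i, Fintype (A i)] (B : Θ → Finset (JA A)) (f : JA A → Θ → ℝ)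
    (u : (i : Fin n) → JA A → Θ → ℝ) (θ : Θ) : AIVal A :=
  (B θ, fun a => if a ∈ B θ then ((f a θ, fun i => u i a θ) : UVec n)
                 else (((0:ℝ), fun _ => (0:ℝ)) : UVec n))

/-- The signal kernel of `AllInfo(B)`. -/
def qAI [∀ i, Fintype (A i)] (B : Θ → Finset (JA A)) (f : JA A → Θ → ℝ)
    (u : (i : Fin n) → JA A → Θ → ℝ) : Θ → AIVal A → ℝ :=
  fun θ v => if v = allInfoVal B f u θ then (1:ℝ) else 0

/-- The set of δ-eventually-explorable joint actions given the state `θ`, for the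
environment `D`: actions played with positive probability in some round by some
δ-BIC iterative recommendation policy. -/
def explSet [Fintype Θ] [∀ i, Fintype (A i)] (ψ : Θ → ℝ)
    (D : JA A → Θ → UVec n → ℝ) (u : (i : Fin n) → JA A → Θ → ℝ) (δ : ℝ)
    (θ : Θ) : Finset (JA A) :=
  (Set.toFinite {a : JA A | ∃ P, IsBIC ψ P D u δ ∧ ∃ t, 0 < probAt P D θ t a}).toFinset

/-- The realized utility vector of the joint action `a` in state `θ`. -/
def outcome (f : JA A → Θ → ℝ) (u : (i : Fin n) → JA A → Θ → ℝ) (θ : Θ) (a : JA A) : UVec n :=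
  (f a θ, fun i => u i a θ)

section

variable {f : JA A → Θ → ℝ} {u : (i : Fin n) → JA A → Θ → ℝ} {P P' : ℕ → Hist A → JA A → ℝ}

lemma histProb_eq_of_outcome_eq {θ θ' : Θ} (hθ : outcome f u θ = outcome f u θ') :
    ∀ h : Hist A, histProb P (detD f u) θ h = histProb P (detD f u) θ' h
  | [] => rfl
  | av :: h => by
    have : (f av.1 θ, fun i => u i av.1 θ) = (f av.1 θ', fun i => u i av.1 θ') :=
      congrFun hθ av.1
    simp only [histProb, histProb_eq_of_outcome_eq hθ h, detD, this]

lemma histProb_congr {θ : Θ} {T : ℕ} (hPP : ∀ t, t < T → ∀ h a, P' t h a = P t h a) :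
    ∀ h : Hist A, h.length ≤ T → histProb P' (detD f u) θ h = histProb P (detD f u) θ h
  | [], _ => rfl
  | av :: h, hl => by
    simp only [List.length_cons] at hl
    simp only [histProb, histProb_congr hPP h (by omega), hPP h.length (by omega)]

lemma histProb_drop_ne_zero {θ : Θ} :
    ∀ (k : ℕ) (h : Hist A), histProb P (detD f u) θ h ≠ 0 →
      histProb P (detD f u) θ (h.drop k) ≠ 0
  | 0, _, hh => hh
  | _ + 1, [], hh => hh
  | k + 1, _ :: h, hh =>
    histProb_drop_ne_zero k h (left_ne_zero_of_mul (left_ne_zero_of_mul hh))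

/-- Follow `P` before round `T`; from then on, use the rule `x` at some state that is consistent
with the observed history. -/
def exploitAfter (f : JA A → Θ → ℝ) (u : (i : Fin n) → JA A → Θ → ℝ)
    (P : ℕ → Hist A → JA A → ℝ) (x : Θ → JA A → ℝ) (T t : ℕ) (h : Hist A) : JA A → ℝ :=
  if hc : T ≤ t ∧ ∃ θ, ∀ pr ∈ h, pr.2 = outcome f u θ pr.1 then x hc.2.choose else P t h

lemma exploitAfter_of_lt {x : Θ → JA A → ℝ} {T t : ℕ} (ht : t < T) (h : Hist A) :
    exploitAfter f u P x T t h = P t h :=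
  dif_neg fun hc => absurd hc.1 (by omega)

end

/-- The histories of length `t` whose realized utilities are those of state `θ`. -/
def reach [∀ i, Fintype (A i)] (f : JA A → Θ → ℝ) (u : (i : Fin n) → JA A → Θ → ℝ) (θ : Θ) :
    ℕ → Finset (Hist A)
  | 0 => {[]}
  | t + 1 => ((Finset.univ : Finset (JA A)) ×ˢ reach f u θ t).image
      (fun p => (p.1, outcome f u θ p.1) :: p.2)

section

variable [∀ i, Fintype (A i)] {f : JA A → Θ → ℝ} {u : (i : Fin n) → JA A → Θ → ℝ}
  {P P' : ℕ → Hist A → JA A → ℝ}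

lemma length_of_mem_reach {θ : Θ} : ∀ {t : ℕ} {h : Hist A}, h ∈ reach f u θ t → h.length = t
  | 0, h, hh => by simpa [reach] using hh
  | t + 1, h, hh => by
    simp only [reach, Finset.mem_image, Finset.mem_product, Finset.mem_univ, true_and] at hh
    obtain ⟨p, hp, rfl⟩ := hh
    simp [length_of_mem_reach hp]

lemma outcome_of_mem_reach {θ : Θ} : ∀ {t : ℕ} {h : Hist A}, h ∈ reach f u θ t →
    ∀ pr ∈ h, pr.2 = outcome f u θ pr.1
  | 0, h, hh => by
    have : h = [] := by simpa [reach] using hh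
    simp [this]
  | t + 1, h, hh => by
    simp only [reach, Finset.mem_image, Finset.mem_product, Finset.mem_univ, true_and] at hh
    obtain ⟨p, hp, rfl⟩ := hh
    intro pr hpr
    rcases List.mem_cons.1 hpr with rfl | hpr
    · rfl
    · exact outcome_of_mem_reach hp pr hpr

lemma mem_reach_of_histProb_ne_zero {θ : Θ} :
    ∀ {h : Hist A}, histProb P (detD f u) θ h ≠ 0 → h ∈ reach f u θ h.length
  | [], _ => by simp [reach]
  | av :: h, hh => by
    simp only [histProb] at hh
    have h1 := mem_reach_of_histProb_ne_zero (left_ne_zero_of_mul (left_ne_zero_of_mul hh))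
    have h2 : av.2 = outcome f u θ av.1 := by
      by_contra hne
      exact right_ne_zero_of_mul hh (if_neg hne)
    simp only [List.length_cons, reach, Finset.mem_image, Finset.mem_product, Finset.mem_univ,
      true_and]
    exact ⟨(av.1, h), h1, by rw [← h2]⟩

lemma tsum_length_eq (θ : Θ) (t : ℕ) (F : Hist A → ℝ) :
    (∑' h : Hist A, if h.length = t then histProb P (detD f u) θ h * F h else 0)
      = ∑ h ∈ reach f u θ t, histProb P (detD f u) θ h * F h := by
  rw [tsum_eq_sum (s := reach f u θ t)]
  · exact Finset.sum_congr rfl fun h hh => if_pos (length_of_mem_reach hh)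
  · intro h hh
    split_ifs with hl
    · by_contra hne
      exact hh (hl ▸ mem_reach_of_histProb_ne_zero (left_ne_zero_of_mul hne))
    · rfl

lemma histProb_nonneg (hP : IsPolicy P) (θ : Θ) :
    ∀ h : Hist A, 0 ≤ histProb P (detD f u) θ h
  | [] => zero_le_one
  | av :: h => by
    refine mul_nonneg (mul_nonneg (histProb_nonneg hP θ h) ((hP _ _).1 _)) ?_
    unfold detD
    split_ifs <;> norm_num

lemma sum_histProb (hP : IsPolicy P) (θ : Θ) :
    ∀ t, ∑ h ∈ reach f u θ t, histProb P (detD f u) θ h = 1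
  | 0 => by simp [reach, histProb]
  | t + 1 => by
    rw [reach, Finset.sum_image, Finset.sum_product_right]
    · rw [← sum_histProb hP θ t]
      refine Finset.sum_congr rfl fun h _ => ?_
      simp only [histProb, detD, outcome, if_true, mul_one]
      rw [← Finset.mul_sum, (hP _ _).2, mul_one]
    · rintro ⟨a, h⟩ _ ⟨b, k⟩ _ hab
      simp only [List.cons.injEq, Prod.mk.injEq] at hab
      exact Prod.ext hab.1.1 hab.2

lemma probAt_eq (θ : Θ) (t : ℕ) (a : JA A) :
    probAt P (detD f u) θ t a
      = ∑ h ∈ reach f u θ t, histProb P (detD f u) θ h * P t h a :=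
  tsum_length_eq θ t fun h => P t h a

lemma roundCond_eq_sum_probAt (θ : Θ) (t : ℕ) (g : JA A → Θ → ℝ) :
    roundCond P (detD f u) θ t g = ∑ a, probAt P (detD f u) θ t a * g a θ := by
  have h1 := tsum_length_eq (P := P) (f := f) (u := u) θ t fun h => ∑ a, P t h a * g a θ
  refine h1.trans ?_
  simp only [probAt_eq, Finset.mul_sum, Finset.sum_mul]
  rw [Finset.sum_comm]
  simp only [mul_assoc]

lemma probAt_mem_stdSimplex (hP : IsPolicy P) (θ : Θ) (t : ℕ) :
    probAt P (detD f u) θ t ∈ stdSimplex ℝ (JA A) := by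
  refine ⟨fun a => ?_, ?_⟩
  · rw [probAt_eq]
    exact Finset.sum_nonneg fun h _ => mul_nonneg (histProb_nonneg hP θ h) ((hP _ _).1 _)
  · simp only [probAt_eq]
    rw [Finset.sum_comm, ← sum_histProb (f := f) (u := u) hP θ t]
    refine Finset.sum_congr rfl fun h _ => ?_
    rw [← Finset.mul_sum, (hP _ _).2, mul_one]

lemma probAt_eq_of_outcome_eq {θ θ' : Θ} (hθ : outcome f u θ = outcome f u θ') (t : ℕ) :
    probAt P (detD f u) θ t = probAt P (detD f u) θ' t := by
  funext a
  simp only [probAt, histProb_eq_of_outcome_eq hθ]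

lemma probAt_congr {θ : Θ} {T : ℕ} (hPP : ∀ t, t < T → ∀ h a, P' t h a = P t h a)
    {t : ℕ} (ht : t < T) : probAt P' (detD f u) θ t = probAt P (detD f u) θ t := by
  funext a
  rw [probAt_eq, probAt_eq]
  refine Finset.sum_congr rfl fun h hh => ?_
  rw [histProb_congr hPP h (by rw [length_of_mem_reach hh]; omega), hPP t ht]

lemma probAt_eq_of_forall {θ : Θ} (hP : IsPolicy P) {t : ℕ} {x : JA A → ℝ}
    (hx : ∀ h ∈ reach f u θ t, histProb P (detD f u) θ h ≠ 0 → P t h = x) :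
    probAt P (detD f u) θ t = x := by
  funext a
  rw [probAt_eq, ← one_mul (x a), ← sum_histProb (f := f) (u := u) hP θ t, Finset.sum_mul]
  refine Finset.sum_congr rfl fun h hh => ?_
  by_cases h0 : histProb P (detD f u) θ h = 0
  · simp [h0]
  · rw [hx h hh h0]

lemma roundExp_eq [Fintype Θ] (ψ : Θ → ℝ) (t : ℕ) (g : JA A → Θ → ℝ) :
    roundExp ψ P (detD f u) t g = ∑ θ, ψ θ * ∑ a, probAt P (detD f u) θ t a * g a θ := by
  simp only [roundExp, roundCond_eq_sum_probAt]

/-- The gain of following the recommendation `ai` over deviating to `ai'`, on the event that `ai`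
is recommended. -/
def gain (u : (i : Fin n) → JA A → Θ → ℝ) (i : Fin n) (ai ai' : A i) (a : JA A) (θ : Θ) : ℝ :=
  if a i = ai then u i a θ - u i (Function.update a i ai') θ else 0

/-- One-round recommendation rules that depend on the state only through the outcomes of all
joint actions, and that satisfy the obedience constraints. -/
def obedientRules [Fintype Θ] (ψ : Θ → ℝ) (f : JA A → Θ → ℝ)
    (u : (i : Fin n) → JA A → Θ → ℝ) : Set (Θ → JA A → ℝ) :=
  {x | (∀ θ, x θ ∈ stdSimplex ℝ (JA A)) ∧
    (∀ θ θ', outcome f u θ = outcome f u θ' → x θ = x θ') ∧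
    ∀ i ai ai', 0 ≤ ∑ θ, ψ θ * ∑ a, x θ a * gain u i ai ai' a θ}

lemma bicAt_zero_iff [Fintype Θ] (ψ : Θ → ℝ) (t : ℕ) :
    BICAt ψ P (detD f u) u 0 t ↔
      ∀ i ai ai', 0 ≤ ∑ θ, ψ θ * ∑ a, probAt P (detD f u) θ t a * gain u i ai ai' a θ := by
  simp only [BICAt, zero_mul, roundExp_eq, gain]

lemma probAt_mem_obedientRules [Fintype Θ] {ψ : Θ → ℝ} (hP : IsBIC ψ P (detD f u) u 0) (t : ℕ) :
    (fun θ => probAt P (detD f u) θ t) ∈ obedientRules ψ f u :=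
  ⟨fun θ => probAt_mem_stdSimplex hP.1 θ t, fun _ _ h => probAt_eq_of_outcome_eq h t,
    (bicAt_zero_iff ψ t).1 (hP.2 t)⟩

lemma isCompact_obedientRules [Fintype Θ] (ψ : Θ → ℝ) : IsCompact (obedientRules ψ f u) := by
  have h1 : IsCompact {x : Θ → JA A → ℝ | ∀ θ, x θ ∈ stdSimplex ℝ (JA A)} := by
    simpa [Set.pi] using
      isCompact_univ_pi fun _ : Θ => isCompact_stdSimplex ℝ (JA A)
  have h2 : IsClosed {x : Θ → JA A → ℝ |
      ∀ θ θ', outcome f u θ = outcome f u θ' → x θ = x θ'} := by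
    simp only [Set.ofPred_forall]
    exact isClosed_iInter fun θ => isClosed_iInter fun θ' => isClosed_iInter fun _ =>
      isClosed_eq (continuous_apply θ) (continuous_apply θ')
  have h3 : IsClosed {x : Θ → JA A → ℝ |
      ∀ i ai ai', 0 ≤ ∑ θ, ψ θ * ∑ a, x θ a * gain u i ai ai' a θ} := by
    simp only [Set.ofPred_forall]
    exact isClosed_iInter fun i => isClosed_iInter fun ai => isClosed_iInter fun ai' =>
      isClosed_le continuous_const (by fun_prop)
  exact h1.inter_right (h2.inter h3)

lemma isPolicy_exploitAfter (hP : IsPolicy P) {x : Θ → JA A → ℝ}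
    (hx : ∀ θ, x θ ∈ stdSimplex ℝ (JA A)) (T : ℕ) : IsPolicy (exploitAfter f u P x T) := by
  intro t h
  unfold exploitAfter
  split_ifs
  · exact hx _
  · exact hP t h

lemma probAt_exploitAfter (hP : IsPolicy P) {x : Θ → JA A → ℝ}
    (hx : ∀ θ, x θ ∈ stdSimplex ℝ (JA A))
    (hxo : ∀ θ θ', outcome f u θ = outcome f u θ' → x θ = x θ') {T t : ℕ} (ht : T ≤ t) {θ : Θ}
    (hexplored : ∀ h : Hist A, h.length = T → 0 < histProb P (detD f u) θ h →
      ∀ a : JA A, ∃ pr ∈ h, pr.1 = a) :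
    probAt (exploitAfter f u P x T) (detD f u) θ t = x θ := by
  refine probAt_eq_of_forall (isPolicy_exploitAfter hP hx T) fun h hh h0 => ?_
  have hout := outcome_of_mem_reach hh
  have hlen := length_of_mem_reach hh
  have hc : T ≤ t ∧ ∃ θ, ∀ pr ∈ h, pr.2 = outcome f u θ pr.1 := ⟨ht, θ, hout⟩
  rw [exploitAfter, dif_pos hc]
  refine hxo _ _ (funext fun a => ?_)
  have hdl : (h.drop (t - T)).length = T := by rw [List.length_drop]; omega
  have hd := histProb_drop_ne_zero (t - T) h h0
  rw [histProb_congr (T := T) (P := P)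
    (fun s hs k a => congrFun (exploitAfter_of_lt hs k) a) _ hdl.le] at hd
  obtain ⟨pr, hpr, rfl⟩ := hexplored _ hdl ((histProb_nonneg hP θ _).lt_of_ne' hd) a
  have hmem := List.mem_of_mem_drop hpr
  rw [← hc.2.choose_spec pr hmem, ← hout pr hmem]

end

/-- (deterministic utilities) if a BIC policy `P` has, with probability 1,
chosen every joint action at least once by a fixed round `Tπ ≤ T`, then there is a BIC
policy `P'` coinciding with `P` before round `Tπ` whose expected reward in every
subsequent round is at least `OPT(Π_BIC)`; consequently
`REW(P') ≥ (T - Tπ) · OPT(Π_BIC)`. -/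
theorem explore_all_then_exploit
    {n : ℕ} {Θ : Type} {A : Fin n → Type} [Fintype Θ] [∀ i, Fintype (A i)]
    (ψ : Θ → ℝ) (f : JA A → Θ → ℝ) (u : (i : Fin n) → JA A → Θ → ℝ)
    (hψ : IsPrior ψ) (hu : IsUtil f u)
    (P : ℕ → Hist A → JA A → ℝ) (hP : IsBIC ψ P (detD f u) u 0)
    (Tπ T : ℕ) (hT : Tπ ≤ T)
    (hexplored : ∀ θ : Θ, 0 < ψ θ → ∀ h : Hist A, h.length = Tπ →
      0 < histProb P (detD f u) θ h → ∀ a : JA A, ∃ pr ∈ h, pr.1 = a) :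
    ∃ P' : ℕ → Hist A → JA A → ℝ,
      IsBIC ψ P' (detD f u) u 0 ∧
      (∀ t, t < Tπ → ∀ h : Hist A, ∀ a : JA A, P' t h a = P t h a) ∧
      (∀ t, Tπ ≤ t →
        OPT ψ (detD f u) f (fun P'' => IsBIC ψ P'' (detD f u) u 0)
          ≤ roundExp ψ P' (detD f u) t f) ∧
      ((T : ℝ) - Tπ) * OPT ψ (detD f u) f (fun P'' => IsBIC ψ P'' (detD f u) u 0)
        ≤ REW ψ P' (detD f u) f T := by
  obtain ⟨x, hxK, hmax⟩ := (isCompact_obedientRules (f := f) (u := u) ψ).exists_isMaxOn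
    ⟨_, probAt_mem_obedientRules hP 0⟩
    (f := fun x : Θ → JA A → ℝ => ∑ θ, ψ θ * ∑ a, x θ a * f a θ)
    (Continuous.continuousOn (by fun_prop))
  have hxS := hxK.1
  set P' := exploitAfter f u P x Tπ
  have hpol : IsPolicy P' := isPolicy_exploitAfter hP.1 hxS Tπ
  have hbefore : ∀ t, t < Tπ → ∀ h : Hist A, ∀ a : JA A, P' t h a = P t h a :=
    fun t ht h a => congrFun (exploitAfter_of_lt ht h) a
  have hafter : ∀ t, Tπ ≤ t → ∀ g : JA A → Θ → ℝ,
      ∑ θ, ψ θ * ∑ a, probAt P' (detD f u) θ t a * g a θ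
        = ∑ θ, ψ θ * ∑ a, x θ a * g a θ := by
    intro t ht g
    refine Finset.sum_congr rfl fun θ _ => ?_
    rcases (hψ.1 θ).eq_or_lt with h0 | h0
    · simp [← h0]
    · rw [probAt_exploitAfter hP.1 hxS hxK.2.1 ht (hexplored θ h0)]
  have hopt : ∀ t, Tπ ≤ t →
      OPT ψ (detD f u) f (fun P'' => IsBIC ψ P'' (detD f u) u 0)
        ≤ roundExp ψ P' (detD f u) t f := by
    intro t ht
    rw [roundExp_eq, hafter t ht]
    refine csSup_le ⟨_, P, hP, 0, rfl⟩ ?_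
    rintro r ⟨Q, hQ, s, rfl⟩
    rw [roundExp_eq]
    exact hmax (probAt_mem_obedientRules hQ s)
  refine ⟨P', ⟨hpol, fun t => ?_⟩, hbefore, hopt, ?_⟩
  · rw [bicAt_zero_iff]
    rcases lt_or_ge t Tπ with ht | ht
    · simp only [probAt_congr hbefore ht]
      exact (bicAt_zero_iff ψ t).1 (hP.2 t)
    · simpa only [hafter t ht] using hxK.2.2
  · have hnonneg : ∀ t, 0 ≤ roundExp ψ P' (detD f u) t f := by
      intro t
      rw [roundExp_eq]
      exact Finset.sum_nonneg fun θ _ => mul_nonneg (hψ.1 θ) (Finset.sum_nonneg fun a _ =>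
        mul_nonneg ((probAt_mem_stdSimplex hpol θ t).1 a) (hu.1 a θ).1)
    calc ((T : ℝ) - Tπ) * OPT ψ (detD f u) f (fun P'' => IsBIC ψ P'' (detD f u) u 0)
        = (Finset.Ico Tπ T).card • OPT ψ (detD f u) f
            (fun P'' => IsBIC ψ P'' (detD f u) u 0) := by
          rw [Nat.card_Ico, nsmul_eq_mul, Nat.cast_sub hT]
      _ ≤ ∑ t ∈ Finset.Ico Tπ T, roundExp ψ P' (detD f u) t f :=
          Finset.card_nsmul_le_sum _ _ _ fun t ht => hopt t (Finset.mem_Ico.1 ht).1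
      _ ≤ REW ψ P' (detD f u) f T :=
          Finset.sum_le_sum_of_subset_of_nonneg
            (fun t ht => Finset.mem_range.2 (Finset.mem_Ico.1 ht).2) fun t _ _ => hnonneg t

end BE

end
end

section
/- Monotonicity in information for rewards: in a recommendation game with coupled signals S and S', if S is at least as informative as S', then REW*[S] ≥ REW*[S']. -/
open scoped BigOperators

attribute [local instance] Classical.propDecidable

noncomputable section

namespace BE

variable {n : ℕ} {Θ : Type} {A : Fin n → Type} {X : Type} {X' : Type}

/-- Marginal kernel of the first signal `S` in a coupling `j` of two signals. -/
def margS {Θ : Type} {X : Type} {X' : Type} (j : Θ → X → X' → ℝ) : Θ → X → ℝ :=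
  fun θ s => ∑' s' : X', j θ s s'

/-- Marginal kernel of the second signal `S'` in a coupling `j` of two signals. -/
def margS' {Θ : Type} {X : Type} {X' : Type} (j : Θ → X → X' → ℝ) : Θ → X' → ℝ :=
  fun θ s' => ∑' s : X, j θ s s'

/-- A coupling of two signals: given the state, a joint distribution over `X × X'`. -/
def IsJointKernel {Θ : Type} {X : Type} {X' : Type} (j : Θ → X → X' → ℝ) : Prop :=
  ∀ θ, (∀ s s', 0 ≤ j θ s s') ∧ HasSum (fun p : X × X' => j θ p.1 p.2) 1

/-- `S` is at least as informative as `S'`: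
`Pr[θ* = θ | S = s, S' = s'] = Pr[θ* = θ | S = s]` whenever `Pr[S = s, S' = s'] > 0`
(stated in cross-multiplied form). -/
def MoreInformative {Θ : Type} {X : Type} {X' : Type} [Fintype Θ]
    (ψ : Θ → ℝ) (j : Θ → X → X' → ℝ) : Prop :=
  ∀ (θ : Θ) (s : X) (s' : X'), 0 < ∑ τ, ψ τ * j τ s s' →
    (ψ θ * j θ s s') * (∑ τ, ψ τ * margS j τ s)
      = (ψ θ * margS j θ s) * (∑ τ, ψ τ * j τ s s')

/-- Joint probability of the signal pair `(s, s')`. -/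
def pairProb [Fintype Θ] (ψ : Θ → ℝ) (j : Θ → X → X' → ℝ) (s : X) (s' : X') : ℝ :=
  ∑ τ, ψ τ * j τ s s'

/-- Probability of the first signal. -/
def fstProb [Fintype Θ] (ψ : Θ → ℝ) (j : Θ → X → X' → ℝ) (s : X) : ℝ :=
  ∑ τ, ψ τ * margS j τ s

/-- The policy for `S` that simulates `S'` from its conditional distribution given `S` and
then follows the policy `y` for `S'`; at signals of probability zero it follows `y` at `s₀`. -/
def simulate [Fintype Θ] (ψ : Θ → ℝ) (j : Θ → X → X' → ℝ) (s₀ : X')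
    (y : JA A → X' → ℝ) : JA A → X → ℝ :=
  fun a s => if fstProb ψ j s = 0 then y a s₀
    else ∑' s', pairProb ψ j s s' / fstProb ψ j s * y a s'

lemma IsRecPolicy.le_one [∀ i, Fintype (A i)] {y : JA A → X → ℝ} (hy : IsRecPolicy y)
    (a : JA A) (s : X) : y a s ≤ 1 := by
  rw [← hy.2 s]
  exact Finset.single_le_sum (f := fun a => y a s) (fun b _ => hy.1 b s) (Finset.mem_univ a)

lemma IsJointKernel.summable_right {j : Θ → X → X' → ℝ} (hj : IsJointKernel j)
    (θ : Θ) (s : X) : Summable (fun s' => j θ s s') :=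
  (hj θ).2.summable.prod_factor s

lemma IsJointKernel.margS_nonneg {j : Θ → X → X' → ℝ} (hj : IsJointKernel j)
    (θ : Θ) (s : X) : 0 ≤ margS j θ s :=
  tsum_nonneg fun s' => (hj θ).1 s s'

lemma pairProb_nonneg [Fintype Θ] {ψ : Θ → ℝ} {j : Θ → X → X' → ℝ} (hψ : IsPrior ψ)
    (hj : IsJointKernel j) (s : X) (s' : X') : 0 ≤ pairProb ψ j s s' :=
  Finset.sum_nonneg fun τ _ => mul_nonneg (hψ.1 τ) ((hj τ).1 s s')

lemma fstProb_nonneg [Fintype Θ] {ψ : Θ → ℝ} {j : Θ → X → X' → ℝ} (hψ : IsPrior ψ)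
    (hj : IsJointKernel j) (s : X) : 0 ≤ fstProb ψ j s :=
  Finset.sum_nonneg fun τ _ => mul_nonneg (hψ.1 τ) (hj.margS_nonneg τ s)

lemma hasSum_pairProb [Fintype Θ] (ψ : Θ → ℝ) {j : Θ → X → X' → ℝ}
    (hj : IsJointKernel j) (s : X) : HasSum (pairProb ψ j s) (fstProb ψ j s) :=
  hasSum_sum fun τ _ => (hj.summable_right τ s).hasSum.mul_left (ψ τ)

lemma summable_simulate [Fintype Θ] [∀ i, Fintype (A i)] {ψ : Θ → ℝ} {j : Θ → X → X' → ℝ}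
    (hψ : IsPrior ψ) (hj : IsJointKernel j) {y : JA A → X' → ℝ} (hy : IsRecPolicy y)
    (a : JA A) (s : X) :
    Summable fun s' => pairProb ψ j s s' / fstProb ψ j s * y a s' := by
  have hk (s' : X') : 0 ≤ pairProb ψ j s s' / fstProb ψ j s :=
    div_nonneg (pairProb_nonneg hψ hj s s') (fstProb_nonneg hψ hj s)
  exact .of_nonneg_of_le (fun s' => mul_nonneg (hk s') (hy.1 a s'))
    (fun s' => mul_le_of_le_one_right (hk s') (hy.le_one a s'))
    ((hasSum_pairProb ψ hj s).summable.div_const _)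

lemma isRecPolicy_simulate [Fintype Θ] [∀ i, Fintype (A i)] {ψ : Θ → ℝ} {j : Θ → X → X' → ℝ}
    (hψ : IsPrior ψ) (hj : IsJointKernel j) (s₀ : X') {y : JA A → X' → ℝ}
    (hy : IsRecPolicy y) : IsRecPolicy (simulate ψ j s₀ y) := by
  refine ⟨fun a s => ?_, fun s => ?_⟩
  · unfold simulate
    split_ifs
    · exact hy.1 a s₀
    · exact tsum_nonneg fun s' => mul_nonneg
        (div_nonneg (pairProb_nonneg hψ hj s s') (fstProb_nonneg hψ hj s)) (hy.1 a s')
  · by_cases h : fstProb ψ j s = 0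
    · simp only [simulate, if_pos h]
      exact hy.2 s₀
    · simp only [simulate, if_neg h]
      rw [← Summable.tsum_finsetSum fun a _ => summable_simulate hψ hj hy a s]
      simp only [← Finset.mul_sum, hy.2, mul_one]
      rw [tsum_div_const, (hasSum_pairProb ψ hj s).tsum_eq, div_self h]

lemma prior_mul_margS_mul_simulate [Fintype Θ] [∀ i, Fintype (A i)] {ψ : Θ → ℝ}
    {j : Θ → X → X' → ℝ} (hψ : IsPrior ψ) (hj : IsJointKernel j) (hMI : MoreInformative ψ j)
    (s₀ : X') (y : JA A → X' → ℝ) (θ : Θ) (a : JA A) (s : X) :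
    ψ θ * margS j θ s * simulate ψ j s₀ y a s = ∑' s', ψ θ * j θ s s' * y a s' := by
  have hzero (s' : X') (h : pairProb ψ j s s' = 0) : ψ θ * j θ s s' = 0 :=
    (Finset.sum_eq_zero_iff_of_nonneg
      fun τ _ => mul_nonneg (hψ.1 τ) ((hj τ).1 s s')).1 h θ (Finset.mem_univ θ)
  by_cases h : fstProb ψ j s = 0
  · have h1 : ψ θ * margS j θ s = 0 :=
      (Finset.sum_eq_zero_iff_of_nonneg
        fun τ _ => mul_nonneg (hψ.1 τ) (hj.margS_nonneg τ s)).1 h θ (Finset.mem_univ θ)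
    have h2 (s' : X') : ψ θ * j θ s s' = 0 := by
      refine hzero s' (le_antisymm ?_ (pairProb_nonneg hψ hj s s'))
      rw [← h]
      exact le_hasSum (hasSum_pairProb ψ hj s) s' fun t _ => pairProb_nonneg hψ hj s t
    simp [h1, h2]
  · simp only [simulate, if_neg h]
    rw [← tsum_mul_left]
    refine tsum_congr fun s' => ?_
    rw [← mul_assoc]
    congr 1
    rcases (pairProb_nonneg hψ hj s s').eq_or_lt with h0 | h0
    · rw [← h0, hzero s' h0.symm]
      simp
    · have := hMI θ s s' h0
      change _ * fstProb ψ j s = _ * pairProb ψ j s s' at this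
      rw [← mul_div_assoc, ← this, mul_div_cancel_right₀ _ h]

/-- Conditionally on the state, simulating `y` yields the same distribution of joint actions
as `y` itself. -/
lemma tsum_simulate [Fintype Θ] [∀ i, Fintype (A i)] {ψ : Θ → ℝ}
    {j : Θ → X → X' → ℝ} (hψ : IsPrior ψ) (hj : IsJointKernel j) (hMI : MoreInformative ψ j)
    (s₀ : X') {y : JA A → X' → ℝ} (hy : IsRecPolicy y) (θ : Θ) (g : JA A → ℝ) :
    ψ θ * ∑' s, margS j θ s * ∑ a, simulate ψ j s₀ y a s * g a =
      ψ θ * ∑' s', margS' j θ s' * ∑ a, y a s' * g a := by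
  have hsum (a : JA A) : Summable fun p : X × X' => ψ θ * j θ p.1 p.2 * y a p.2 := by
    have hk (p : X × X') : 0 ≤ ψ θ * j θ p.1 p.2 := mul_nonneg (hψ.1 θ) ((hj θ).1 _ _)
    exact .of_nonneg_of_le (fun p => mul_nonneg (hk p) (hy.1 a p.2))
      (fun p => mul_le_of_le_one_right (hk p) (hy.le_one a p.2))
      ((hj θ).2.summable.mul_left _)
  have hleft (s : X) : ψ θ * (margS j θ s * ∑ a, simulate ψ j s₀ y a s * g a) =
      ∑ a, (∑' s', ψ θ * j θ s s' * y a s') * g a := by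
    simp only [← prior_mul_margS_mul_simulate hψ hj hMI s₀ y θ, Finset.mul_sum]
    exact Finset.sum_congr rfl fun a _ => by ring
  have hright (s' : X') : ψ θ * (margS' j θ s' * ∑ a, y a s' * g a) =
      ∑ a, (∑' s, ψ θ * j θ s s' * y a s') * g a := by
    simp only [tsum_mul_right, tsum_mul_left, Finset.mul_sum]
    exact Finset.sum_congr rfl fun a _ => by unfold margS'; ring
  have hswap (a : JA A) : Summable fun s' : X' => ∑' s : X, ψ θ * j θ s s' * y a s' :=
    (hsum a).prod_symm.prod
  rw [← tsum_mul_left, ← tsum_mul_left]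
  simp only [hleft, hright]
  rw [Summable.tsum_finsetSum fun a _ => (hsum a).prod.mul_right (g a),
    Summable.tsum_finsetSum fun a _ => (hswap a).mul_right (g a)]
  refine Finset.sum_congr rfl fun a _ => ?_
  rw [tsum_mul_right, tsum_mul_right]
  congr 1
  exact ((hsum a).tsum_comm).symm

lemma recREW_simulate [Fintype Θ] [∀ i, Fintype (A i)] {ψ : Θ → ℝ}
    {j : Θ → X → X' → ℝ} (hψ : IsPrior ψ) (hj : IsJointKernel j) (hMI : MoreInformative ψ j)
    (s₀ : X') {y : JA A → X' → ℝ} (hy : IsRecPolicy y) (g : JA A → Θ → ℝ) :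
    recREW ψ (margS j) g (simulate ψ j s₀ y) = recREW ψ (margS' j) g y :=
  Finset.sum_congr rfl fun θ _ => tsum_simulate hψ hj hMI s₀ hy θ fun a => g a θ

lemma inBIC_zero_iff [Fintype Θ] [∀ i, Fintype (A i)] {ψ : Θ → ℝ} {q : Θ → X → ℝ}
    {u : (i : Fin n) → JA A → Θ → ℝ} {x : JA A → X → ℝ} :
    InBIC ψ q u 0 x ↔ IsRecPolicy x ∧ ∀ (i : Fin n) (ai ai' : A i),
      0 ≤ recREW ψ q
        (fun a θ => if a i = ai then u i a θ - u i (Function.update a i ai') θ else 0) x := by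
  simp only [InBIC, recREW, zero_mul, mul_comm (x _ _), ite_mul]

lemma InBIC.simulate [Fintype Θ] [∀ i, Fintype (A i)] {ψ : Θ → ℝ}
    {j : Θ → X → X' → ℝ} {u : (i : Fin n) → JA A → Θ → ℝ} (hψ : IsPrior ψ)
    (hj : IsJointKernel j) (hMI : MoreInformative ψ j) (s₀ : X') {y : JA A → X' → ℝ}
    (hy : InBIC ψ (margS' j) u 0 y) : InBIC ψ (margS j) u 0 (simulate ψ j s₀ y) := by
  rw [inBIC_zero_iff] at hy ⊢
  refine ⟨isRecPolicy_simulate hψ hj s₀ hy.1, fun i ai ai' => ?_⟩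
  rw [recREW_simulate hψ hj hMI s₀ hy.1]
  exact hy.2 i ai ai'

lemma IsJointKernel.hasSum_margS {j : Θ → X → X' → ℝ} (hj : IsJointKernel j) (θ : Θ) :
    HasSum (margS j θ) 1 :=
  (hj θ).2.prod_fiberwise fun s => (hj.summable_right θ s).hasSum

lemma IsRecPolicy.sum_mul_mem_Icc [∀ i, Fintype (A i)] {x : JA A → X → ℝ}
    (hx : IsRecPolicy x) {g : JA A → ℝ} (hg : ∀ a, g a ∈ Set.Icc (0 : ℝ) 1) (s : X) :
    ∑ a, x a s * g a ∈ Set.Icc (0 : ℝ) 1 := by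
  refine ⟨Finset.sum_nonneg fun a _ => mul_nonneg (hx.1 a s) (hg a).1, ?_⟩
  rw [← hx.2 s]
  exact Finset.sum_le_sum fun a _ => mul_le_of_le_one_right (hx.1 a s) (hg a).2

lemma recREW_mem_Icc [Fintype Θ] [∀ i, Fintype (A i)] {ψ : Θ → ℝ} {q : Θ → X → ℝ}
    {f : JA A → Θ → ℝ} {x : JA A → X → ℝ} (hψ : IsPrior ψ) (hq : IsSigKernel q)
    (hf : ∀ a θ, f a θ ∈ Set.Icc (0 : ℝ) 1) (hx : IsRecPolicy x) :
    recREW ψ q f x ∈ Set.Icc (0 : ℝ) 1 := by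
  have hG (θ : Θ) (s : X) := hx.sum_mul_mem_Icc (fun a => hf a θ) s
  have hnonneg (θ : Θ) (s : X) : 0 ≤ q θ s * ∑ a, x a s * f a θ :=
    mul_nonneg ((hq θ).1 s) (hG θ s).1
  have hle (θ : Θ) (s : X) : q θ s * ∑ a, x a s * f a θ ≤ q θ s :=
    mul_le_of_le_one_right ((hq θ).1 s) (hG θ s).2
  refine ⟨Finset.sum_nonneg fun θ _ => mul_nonneg (hψ.1 θ) (tsum_nonneg (hnonneg θ)), ?_⟩
  rw [← hψ.2]
  refine Finset.sum_le_sum fun θ _ => mul_le_of_le_one_right (hψ.1 θ) ?_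
  rw [← (hq θ).2.tsum_eq]
  exact Summable.tsum_le_tsum (hle θ)
    (.of_nonneg_of_le (hnonneg θ) (hle θ) (hq θ).2.summable) (hq θ).2.summable

/-- monotonicity in information for rewards. In a recommendation game
with coupled signals `S, S'` (joint kernel `j`), if `S` is at least as informative as
`S'`, then `REW*[S] ≥ REW*[S']`. -/
theorem monotonicity_in_information_rewards
    {n : ℕ} {Θ : Type} {A : Fin n → Type} {X : Type} {X' : Type}
    [Fintype Θ] [∀ i, Fintype (A i)]
    (ψ : Θ → ℝ) (f : JA A → Θ → ℝ) (u : (i : Fin n) → JA A → Θ → ℝ)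
    (j : Θ → X → X' → ℝ)
    (hψ : IsPrior ψ) (hu : IsUtil f u) (hj : IsJointKernel j)
    (hMI : MoreInformative ψ j) :
    REWstar ψ (margS' j) f u 0 ≤ REWstar ψ (margS j) f u 0 := by
  have hq : IsSigKernel (margS j) := fun θ => ⟨hj.margS_nonneg θ, hj.hasSum_margS θ⟩
  have hmem (x : JA A → X → ℝ) (hx : InBIC ψ (margS j) u 0 x) :
      recREW ψ (margS j) f x ∈ Set.Icc (0 : ℝ) 1 := recREW_mem_Icc hψ hq hu.1 hx.1
  obtain ⟨s₀⟩ : Nonempty X' := by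
    by_contra h
    rw [not_nonempty_iff] at h
    have : Nonempty Θ := by
      by_contra hΘ
      rw [not_nonempty_iff] at hΘ
      simpa using hψ.2
    exact zero_ne_one (hasSum_empty.unique (hj (Classical.arbitrary Θ)).2)
  refine Real.sSup_le ?_ (Real.sSup_nonneg ?_)
  · rintro r ⟨y, hy, rfl⟩
    refine le_csSup ⟨1, ?_⟩
      ⟨simulate ψ j s₀ y, hy.simulate hψ hj hMI s₀, (recREW_simulate hψ hj hMI s₀ hy.1 f).symm⟩
    rintro r ⟨x, hx, rfl⟩
    exact (hmem x hx).2
  · rintro r ⟨x, hx, rfl⟩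
    exact (hmem x hx).1


end BE

end
end

section
/- Composition of BIC subroutines: fix the utility structure. If σ and σ' are BIC subroutines such that σ' is a valid sequel of σ (the pair consisting of σ's input signal and σ's history determines σ''s input signal), then the composition σ ⊕ σ', which runs σ for its duration and then σ' for its duration, is a BIC subroutine. -/
open scoped BigOperators

attribute [local instance] Classical.propDecidable

noncomputable section

namespace BE

variable {n : ℕ} {Θ : Type} {A : Fin n → Type} {X : Type} {X' : Type}

/-- A subroutine's recommendation kernel: per-round conditional action distributions
given the realized input signal and the history observed so far. -/
def IsSPolicy {n : ℕ} {A : Fin n → Type} {X : Type} [∀ i, Fintype (A i)]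
    (P : ℕ → X → Hist A → JA A → ℝ) : Prop :=
  ∀ t x h, (∀ a, 0 ≤ P t x h a) ∧ ∑ a : JA A, P t x h a = 1

/-- Expectation of `g (aₜ, θ*)` in round `t` of a subroutine with signal kernel `q`. -/
def roundExpS {n : ℕ} {Θ : Type} {A : Fin n → Type} {X : Type}
    [Fintype Θ] [∀ i, Fintype (A i)]
    (ψ : Θ → ℝ) (q : Θ → X → ℝ) (P : ℕ → X → Hist A → JA A → ℝ)
    (D : JA A → Θ → UVec n → ℝ) (t : ℕ) (g : JA A → Θ → ℝ) : ℝ :=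
  ∑ θ, ψ θ * ∑' x : X, q θ x * roundCond (fun t' h => P t' x h) D θ t g

/-- δ-Bayesian incentive-compatibility of a subroutine at round `t`, in the
indicator-weighted form. -/
def SBICAt {n : ℕ} {Θ : Type} {A : Fin n → Type} {X : Type}
    [Fintype Θ] [∀ i, Fintype (A i)]
    (ψ : Θ → ℝ) (q : Θ → X → ℝ) (P : ℕ → X → Hist A → JA A → ℝ)
    (D : JA A → Θ → UVec n → ℝ) (u : (i : Fin n) → JA A → Θ → ℝ)
    (δ : ℝ) (t : ℕ) : Prop :=
  ∀ (i : Fin n) (ai ai' : A i),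
    δ * roundExpS ψ q P D t (fun a _ => if a i = ai then 1 else 0) ≤
      roundExpS ψ q P D t
        (fun a θ => if a i = ai then u i a θ - u i (Function.update a i ai') θ else 0)

theorem hasSum_prod_of_nonneg {α β : Type*} {F : α × β → ℝ} {G : α → ℝ} {c : ℝ}
    (hF : 0 ≤ F) (hG : ∀ a, HasSum (fun b => F (a, b)) (G a)) (hc : HasSum G c) :
    HasSum F c := by
  have hs : Summable F := (summable_prod_of_nonneg hF).2
    ⟨fun a => (hG a).summable, hc.summable.congr fun a => (hG a).tsum_eq.symm⟩
  have h := hs.hasSum.prod_fiberwise hG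
  rw [hc.unique h]
  exact hs.hasSum

theorem histProb_nonneg_s8 {n : ℕ} {Θ : Type} {A : Fin n → Type} [∀ i, Fintype (A i)]
    {P : ℕ → Hist A → JA A → ℝ} {D : JA A → Θ → UVec n → ℝ} {θ : Θ}
    (hP : IsPolicy P) (hD : ∀ a, IsDPMF (D a θ)) (h : Hist A) :
    0 ≤ histProb P D θ h := by
  induction h with
  | nil => exact zero_le_one
  | cons av h ih => exact mul_nonneg (mul_nonneg ih ((hP _ _).1 _)) ((hD _).1 _)

/-- The histories of a fixed length carry total probability one. -/
theorem hasSum_histProb {n : ℕ} {Θ : Type} {A : Fin n → Type} [∀ i, Fintype (A i)]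
    {P : ℕ → Hist A → JA A → ℝ} {D : JA A → Θ → UVec n → ℝ} {θ : Θ}
    (hP : IsPolicy P) (hD : ∀ a, IsDPMF (D a θ)) (t : ℕ) :
    HasSum (fun h : Hist A => if h.length = t then histProb P D θ h else 0) 1 := by
  induction t with
  | zero =>
    convert hasSum_ite_eq ([] : Hist A) (1 : ℝ) using 2 with h
    cases h <;> simp [histProb]
  | succ t ih =>
    have hinj : Function.Injective
        (fun p : Hist A × (JA A × UVec n) => (p.2 :: p.1 : Hist A)) := by
      rintro ⟨h, av⟩ ⟨h', av'⟩ e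
      simp only [List.cons.injEq] at e
      exact Prod.ext e.2 e.1
    refine (hinj.hasSum_iff ?_).1 ?_
    · intro h hh
      cases h with
      | nil => simp
      | cons av h => exact absurd ⟨(h, av), rfl⟩ hh
    · refine hasSum_prod_of_nonneg (G := fun h : Hist A =>
        if h.length = t then histProb P D θ h else 0) ?_ ?_ ih
      · rintro ⟨h, av⟩
        simp only [Function.comp, Pi.zero_apply]
        split_ifs
        exacts [histProb_nonneg_s8 hP hD _, le_rfl]
      · intro h
        by_cases hl : h.length = t
        · have key : HasSum (fun av : JA A × UVec n => P h.length h av.1 * D av.1 θ av.2) 1 := by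
            refine hasSum_prod_of_nonneg (G := fun a => P h.length h a) ?_ ?_ ?_
            · exact fun av => mul_nonneg ((hP _ _).1 _) ((hD _).1 _)
            · intro a
              simpa using (hD a).2.mul_left (P h.length h a)
            · rw [← (hP h.length h).2]
              exact hasSum_fintype _
          simpa [Function.comp, hl, histProb, mul_assoc] using key.mul_left (histProb P D θ h)
        · simp [Function.comp, hl, hasSum_zero]

theorem norm_roundTerm_le {n : ℕ} {Θ : Type} {A : Fin n → Type} [∀ i, Fintype (A i)]
    {P : ℕ → Hist A → JA A → ℝ} {D : JA A → Θ → UVec n → ℝ} {θ : Θ}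
    (hP : IsPolicy P) (hD : ∀ a, IsDPMF (D a θ)) (t : ℕ) (g : JA A → Θ → ℝ) (h : Hist A) :
    ‖if h.length = t then histProb P D θ h * ∑ a : JA A, P t h a * g a θ else 0‖ ≤
      (if h.length = t then histProb P D θ h else 0) * ∑ a : JA A, |g a θ| := by
  split_ifs with hl
  · have h0 := histProb_nonneg_s8 hP hD h
    rw [norm_mul, Real.norm_of_nonneg h0]
    refine mul_le_mul_of_nonneg_left ((norm_sum_le _ _).trans ?_) h0
    refine Finset.sum_le_sum fun a _ => ?_
    have ha := (hP t h).1
    rw [norm_mul, Real.norm_of_nonneg (ha a), Real.norm_eq_abs]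
    refine mul_le_of_le_one_left (abs_nonneg _) ?_
    rw [← (hP t h).2]
    exact Finset.single_le_sum (fun b _ => ha b) (Finset.mem_univ a)
  · simp

theorem norm_roundCond_le {n : ℕ} {Θ : Type} {A : Fin n → Type} [∀ i, Fintype (A i)]
    {P : ℕ → Hist A → JA A → ℝ} {D : JA A → Θ → UVec n → ℝ} {θ : Θ}
    (hP : IsPolicy P) (hD : ∀ a, IsDPMF (D a θ)) (t : ℕ) (g : JA A → Θ → ℝ) :
    ‖roundCond P D θ t g‖ ≤ ∑ a : JA A, |g a θ| := by
  have h := (hasSum_histProb hP hD t).mul_right (∑ a : JA A, |g a θ|)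
  rw [one_mul] at h
  exact tsum_of_norm_bounded h (norm_roundTerm_le hP hD t g)

theorem summable_roundTerm {n : ℕ} {Θ : Type} {A : Fin n → Type} [∀ i, Fintype (A i)]
    {P : ℕ → Hist A → JA A → ℝ} {D : JA A → Θ → UVec n → ℝ} {θ : Θ}
    (hP : IsPolicy P) (hD : ∀ a, IsDPMF (D a θ)) (t : ℕ) (g : JA A → Θ → ℝ) :
    Summable (fun h : Hist A =>
      if h.length = t then histProb P D θ h * ∑ a : JA A, P t h a * g a θ else 0) :=
  Summable.of_norm_bounded ((hasSum_histProb hP hD t).mul_right _).summable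
    (norm_roundTerm_le hP hD t g)

theorem histProb_congr_s8 {n : ℕ} {Θ : Type} {A : Fin n → Type}
    {P Q : ℕ → Hist A → JA A → ℝ} {D : JA A → Θ → UVec n → ℝ} {θ : Θ} {T : ℕ}
    (hPQ : ∀ t < T, ∀ h a, P t h a = Q t h a) (h : Hist A) (hl : h.length ≤ T) :
    histProb P D θ h = histProb Q D θ h := by
  induction h with
  | nil => rfl
  | cons av h ih =>
    rw [List.length_cons] at hl
    simp only [histProb]
    rw [ih (by omega), hPQ _ (by omega)]

theorem histProb_append {n : ℕ} {Θ : Type} {A : Fin n → Type}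
    {P Q : ℕ → Hist A → JA A → ℝ} {D : JA A → Θ → UVec n → ℝ} {θ : Θ} (h₁ : Hist A)
    (hPQ : ∀ (h₂ : Hist A) a, P (h₁.length + h₂.length) (h₂ ++ h₁) a = Q h₂.length h₂ a)
    (h₂ : Hist A) :
    histProb P D θ (h₂ ++ h₁) = histProb P D θ h₁ * histProb Q D θ h₂ := by
  induction h₂ with
  | nil => simp [histProb]
  | cons av h₂ ih =>
    simp only [List.cons_append, histProb]
    rw [ih, List.length_append, add_comm h₂.length, hPQ]
    ring

/-- Splitting a round expectation according to the history of the first `T` rounds. -/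
theorem roundCond_add {n : ℕ} {Θ : Type} {A : Fin n → Type} [∀ i, Fintype (A i)]
    {P : ℕ → Hist A → JA A → ℝ} {Q : Hist A → ℕ → Hist A → JA A → ℝ}
    {D : JA A → Θ → UVec n → ℝ} {θ : Θ} (hP : IsPolicy P) (hD : ∀ a, IsDPMF (D a θ)) {T : ℕ}
    (hPQ : ∀ (h₁ h₂ : Hist A) a, h₁.length = T →
      P (T + h₂.length) (h₂ ++ h₁) a = Q h₁ h₂.length h₂ a)
    (s : ℕ) (g : JA A → Θ → ℝ) :
    roundCond P D θ (T + s) g = ∑' h₁ : Hist A,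
      (if h₁.length = T then histProb P D θ h₁ else 0) * roundCond (Q h₁) D θ s g := by
  let F : Hist A → ℝ := fun h =>
    if h.length = T + s then histProb P D θ h * ∑ a : JA A, P (T + s) h a * g a θ else 0
  let e : {h₁ : Hist A | h₁.length = T} × Hist A → Hist A := fun p => p.2 ++ p.1.1
  have he : Function.Injective e := by
    rintro ⟨⟨h₁, hl₁⟩, h₂⟩ ⟨⟨k₁, hk₁⟩, k₂⟩ h
    have hl : h₁.length = k₁.length := Eq.trans hl₁ (Eq.symm hk₁)
    obtain ⟨rfl, rfl⟩ := List.append_inj' h hl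
    rfl
  have hF : Summable F := summable_roundTerm hP hD (T + s) g
  have hsupp : Function.support F ⊆ Set.range e := by
    intro h hh
    have hl : h.length = T + s := by
      by_contra hne
      exact hh (if_neg hne)
    refine ⟨(⟨h.drop s, ?_⟩, h.take s), List.take_append_drop s h⟩
    simp [hl]
  have h1 : roundCond P D θ (T + s) g = ∑' p, F (e p) := (he.tsum_eq hsupp).symm
  rw [h1, (hF.comp_injective he).tsum_prod (f := fun p => F (e p))]
  have h2 : ∀ h₁ : {h₁ : Hist A | h₁.length = T}, ∑' h₂, F (e (h₁, h₂)) =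
      histProb P D θ h₁ * roundCond (Q h₁) D θ s g := by
    rintro ⟨h₁, hl₁⟩
    have hl₁' : h₁.length = T := hl₁
    rw [roundCond, ← tsum_mul_left]
    refine tsum_congr fun h₂ => ?_
    by_cases hl : h₂.length = s
    · have hL : (h₂ ++ h₁).length = T + s := by rw [List.length_append, hl, hl₁', add_comm]
      have ha := histProb_append (D := D) (θ := θ) h₁ (Q := Q h₁)
        (fun k a => by rw [hl₁']; exact hPQ h₁ k a hl₁') h₂
      simp only [F, e, if_pos hL, if_pos hl, ha, mul_assoc]
      subst hl
      simp only [hPQ h₁ h₂ _ hl₁']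
    · have hL : (h₂ ++ h₁).length ≠ T + s := by rw [List.length_append, hl₁']; omega
      simp only [F, e, if_neg hL, if_neg hl, mul_zero]
  rw [tsum_congr h2, tsum_subtype {h₁ : Hist A | h₁.length = T}
    (fun h₁ => histProb P D θ h₁ * roundCond (Q h₁) D θ s g)]
  refine tsum_congr fun h₁ => ?_
  by_cases hl : h₁.length = T <;> simp [Set.indicator, hl]

/-- Change of variables for sums against a pushforward weight. -/
theorem tsum_fiber_mul {α β : Type*} {w : α → ℝ} (hw : Summable w) (φ : α → β)
    {R : β → ℝ} {C : ℝ} (hR : ∀ b, ‖R b‖ ≤ C) :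
    ∑' b, (∑' a, if φ a = b then w a else 0) * R b = ∑' a, w a * R (φ a) := by
  have hs : Summable (fun a => w a * R (φ a)) := by
    refine Summable.of_norm_bounded (hw.norm.mul_right C) fun a => ?_
    rw [norm_mul]
    exact mul_le_mul_of_nonneg_left (hR _) (norm_nonneg _)
  let F : α → β → ℝ := fun a b => if φ a = b then w a * R b else 0
  have hF : Summable (Function.uncurry F) := by
    have hinj : Function.Injective (fun a => (a, φ a)) := fun a a' h => congrArg Prod.fst h
    refine (hinj.summable_iff ?_).1 (hs.congr fun a => ?_)
    · rintro ⟨a, b⟩ hab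
      exact if_neg fun h => hab ⟨a, congrArg (Prod.mk a) h⟩
    · simp [F]
  calc ∑' b, (∑' a, if φ a = b then w a else 0) * R b
      = ∑' b, ∑' a, F a b := by
        refine tsum_congr fun b => ?_
        rw [← tsum_mul_right]
        refine tsum_congr fun a => ?_
        simp only [F, ite_mul, zero_mul]
    _ = ∑' a, ∑' b, F a b := hF.tsum_comm
    _ = ∑' a, w a * R (φ a) := by
        refine tsum_congr fun a => ?_
        rw [tsum_eq_single (φ a) fun b hb => if_neg fun h => hb h.symm]
        simp

/-- composition of BIC subroutines. If `P` (signal kernel `q`, duration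
`T1`) and `P'` (signal kernel `q'`, duration `T2`) are BIC subroutines and `P'` is a
valid sequel of `P` — the input signal of `P'` is determined, via `nextSig`, by `P`'s
input signal and history, so that `q'` is the induced distribution — then the
composition `Pc` (running `P` for `T1` rounds and then `P'` for `T2` rounds) is a BIC
subroutine of duration `T1 + T2`. -/
theorem composition_of_BIC_subroutines
    {n : ℕ} {Θ : Type} {A : Fin n → Type} {X : Type} {X' : Type}
    [Fintype Θ] [∀ i, Fintype (A i)]
    (ψ : Θ → ℝ) (f : JA A → Θ → ℝ) (u : (i : Fin n) → JA A → Θ → ℝ)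
    (D : JA A → Θ → UVec n → ℝ)
    (hψ : IsPrior ψ) (hu : IsUtil f u) (hD : IsEnv D f u)
    (q : Θ → X → ℝ) (q' : Θ → X' → ℝ)
    (hq : IsSigKernel q) (hq' : IsSigKernel q')
    (P : ℕ → X → Hist A → JA A → ℝ) (P' : ℕ → X' → Hist A → JA A → ℝ)
    (T1 T2 : ℕ)
    (hP : IsSPolicy P) (hPbic : ∀ t, t < T1 → SBICAt ψ q P D u 0 t)
    (hP' : IsSPolicy P') (hP'bic : ∀ t, t < T2 → SBICAt ψ q' P' D u 0 t)
    (nextSig : X → Hist A → X')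
    (hvalid : ∀ (θ : Θ) (x' : X'), q' θ x' =
      ∑' x : X, q θ x * ∑' h : Hist A,
        (if h.length = T1 ∧ nextSig x h = x'
         then histProb (fun t h' => P t x h') D θ h else 0))
    (Pc : ℕ → X → Hist A → JA A → ℝ)
    (hPc : ∀ t x h a, Pc t x h a =
      if t < T1 then P t x h a
      else P' (t - T1) (nextSig x (h.drop (h.length - T1))) (h.take (h.length - T1)) a) :
    IsSPolicy Pc ∧ ∀ t, t < T1 + T2 → SBICAt ψ q Pc D u 0 t := by
  have hPol : ∀ x, IsPolicy (fun t h => P t x h) := fun x t h => hP t x h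
  have hPol' : ∀ x', IsPolicy (fun t h => P' t x' h) := fun x' t h => hP' t x' h
  have hPcS : IsSPolicy Pc := by
    intro t x h
    simp only [hPc]
    split_ifs
    exacts [hP _ _ _, hP' _ _ _]
  have hPolc : ∀ x, IsPolicy (fun t h => Pc t x h) := fun x t h => hPcS t x h
  have hDm : ∀ θ a, IsDPMF (D a θ) := fun θ a => (hD a θ).1
  have hlt : ∀ x, ∀ t < T1, ∀ h a, Pc t x h a = P t x h a := fun x t ht h a => by
    rw [hPc, if_pos ht]
  have hhist : ∀ x θ (h : Hist A), h.length ≤ T1 →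
      histProb (fun t h' => Pc t x h') D θ h = histProb (fun t h' => P t x h') D θ h :=
    fun x θ h hl => histProb_congr_s8 (hlt x) h hl
  have hfirst : ∀ t < T1, ∀ g : JA A → Θ → ℝ,
      roundExpS ψ q Pc D t g = roundExpS ψ q P D t g := by
    intro t ht g
    refine Finset.sum_congr rfl fun θ _ => congrArg _ (tsum_congr fun x => congrArg _ ?_)
    refine tsum_congr fun h => ?_
    split_ifs with hl
    · rw [hhist x θ h (by omega)]
      simp only [hlt x t ht]
    · rfl
  have hsecond : ∀ s, ∀ g : JA A → Θ → ℝ,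
      roundExpS ψ q Pc D (T1 + s) g = roundExpS ψ q' P' D s g := by
    intro s g
    refine Finset.sum_congr rfl fun θ _ => congrArg _ ?_
    let R : X' → ℝ := fun x' => roundCond (fun t h => P' t x' h) D θ s g
    have hR : ∀ x', ‖R x'‖ ≤ ∑ a : JA A, |g a θ| := fun x' =>
      norm_roundCond_le (hPol' x') (hDm θ) s g
    let m : X → Hist A → ℝ := fun x h =>
      if h.length = T1 then histProb (fun t h' => P t x h') D θ h else 0
    have hm0 : ∀ x h, 0 ≤ m x h := fun x h => by
      simp only [m]
      split_ifs
      exacts [histProb_nonneg_s8 (hPol x) (hDm θ) h, le_rfl]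
    let w : X × Hist A → ℝ := fun p => q θ p.1 * m p.1 p.2
    have hw : Summable w := by
      refine (hasSum_prod_of_nonneg (fun p => mul_nonneg ((hq θ).1 _) (hm0 _ _)) ?_
        (hq θ).2).summable
      intro x
      simpa [w, m] using (hasSum_histProb (hPol x) (hDm θ) T1).mul_left (q θ x)
    let φ : X × Hist A → X' := fun p => nextSig p.1 p.2
    have hsplit : ∀ x, roundCond (fun t h => Pc t x h) D θ (T1 + s) g =
        ∑' h, m x h * R (nextSig x h) := by
      intro x
      rw [roundCond_add (hPolc x) (hDm θ)
        (Q := fun h₁ t h₂ => P' t (nextSig x h₁) h₂) (T := T1)]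
      · refine tsum_congr fun h => ?_
        simp only [m, R]
        split_ifs with hl
        · rw [hhist x θ h hl.le]
        · rfl
      · intro h₁ h₂ a hl
        simp [hPc, hl]
    have hws : Summable fun p => w p * R (φ p) := by
      refine Summable.of_norm_bounded (hw.norm.mul_right (∑ a : JA A, |g a θ|)) fun p => ?_
      rw [norm_mul]
      exact mul_le_mul_of_nonneg_left (hR _) (norm_nonneg _)
    have hq'w : ∀ x', q' θ x' = ∑' p, if φ p = x' then w p else 0 := by
      intro x'
      have hs : Summable fun p => if φ p = x' then w p else 0 := by
        refine Summable.of_norm_bounded hw.norm fun p => ?_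
        split_ifs
        exacts [le_rfl, by simp]
      rw [hvalid, hs.tsum_prod]
      refine tsum_congr fun x => ?_
      rw [← tsum_mul_left]
      refine tsum_congr fun h => ?_
      by_cases h1 : h.length = T1 <;> by_cases h2 : nextSig x h = x' <;> simp [φ, w, m, h1, h2]
    calc ∑' x, q θ x * roundCond (fun t h => Pc t x h) D θ (T1 + s) g
        = ∑' x, ∑' h, w (x, h) * R (φ (x, h)) := by
          refine tsum_congr fun x => ?_
          rw [hsplit, ← tsum_mul_left]
          exact tsum_congr fun h => (mul_assoc _ _ _).symm
      _ = ∑' p, w p * R (φ p) := hws.tsum_prod.symm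
      _ = ∑' x', (∑' p, if φ p = x' then w p else 0) * R x' := (tsum_fiber_mul hw φ hR).symm
      _ = ∑' x', q' θ x' * R x' := tsum_congr fun x' => by rw [← hq'w]
  refine ⟨hPcS, fun t ht i ai ai' => ?_⟩
  by_cases h1 : t < T1
  · rw [hfirst t h1, hfirst t h1]
    exact hPbic t h1 i ai ai'
  · obtain ⟨s, rfl⟩ := Nat.exists_eq_add_of_le (not_lt.1 h1)
    rw [hsecond, hsecond]
    exact hP'bic s (by omega) i ai ai'

end BE

end
end
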